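/- Let α be an irrational number of finite exponential type at most τ⋆ where 0 < τ⋆ < 1, and let ϖ ∈ (0, 1/τ⋆ − 1). Then there exists Q_0 > 0 (depending on α and ϖ) such that for every real Q ≥ Q_0 there exist integers a and q with gcd(a, q) = 1, (log Q)^{ϖ+1} < q ≤ Q, and |α − a/q| < 1/(qQ). -/

import Mathlib

open Filter Real

/-- Distance from a real number to the nearest integer. -/
noncomputable def nearInt (t : ℝ) : ℝ := ⨅ n : ℤ, |t - (n : ℝ)|

/-- An irrational number `α` is of finite exponential type at most `τ⋆` if for every
`θ > τ⋆`, `liminf_{q → ∞, q ∈ ℕ} exp(q^θ) ‖qα‖ > 0` (liminf taken in the extended reals). -/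
def FiniteExpTypeAtMost (α τ : ℝ) : Prop :=
  ∀ θ : ℝ, τ < θ →
    (0 : EReal) < Filter.liminf
      (fun q : ℕ => ((Real.exp ((q : ℝ) ^ θ) * nearInt ((q : ℝ) * α) : ℝ) : EReal)) Filter.atTop

theorem nearInt_le_abs_sub_intCast (t : ℝ) (n : ℤ) : nearInt t ≤ |t - n| :=
  ciInf_le ⟨0, by rintro _ ⟨m, rfl⟩; exact abs_nonneg _⟩ n

theorem Irrational.nearInt_pos {t : ℝ} (ht : Irrational t) : 0 < nearInt t := by
  refine lt_of_lt_of_le (b := |t - round t|) ?_ (le_ciInf fun n => round_le t n)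
  exact abs_pos.2 (sub_ne_zero.2 (ht.ne_int _))

/-- A real function on `ℕ`, positive at positive integers and eventually bounded below by a
positive constant, is bounded below by a positive constant at all positive integers. -/
theorem exists_pos_lt_of_eventually_lt {f : ℕ → ℝ} {c : ℝ} (hc : 0 < c)
    (hf : ∀ q, 0 < q → 0 < f q) (h : ∀ᶠ q in atTop, c < f q) :
    ∃ ε > 0, ∀ q, 0 < q → ε < f q := by
  obtain ⟨N, hN⟩ := eventually_atTop.1 h
  have hsmall : ∀ᶠ ε in nhdsWithin (0 : ℝ) (Set.Ioi 0), ∀ q ∈ Finset.Ico 1 N, ε < f q :=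
    (eventually_all_finset _).2 fun q hq =>
      nhdsWithin_le_nhds (eventually_lt_nhds (hf q (Finset.mem_Ico.1 hq).1))
  obtain ⟨ε, hε, hεc, hεf⟩ := (eventually_mem_nhdsWithin.and
    ((eventually_nhdsWithin_of_eventually_nhds (eventually_lt_nhds hc)).and hsmall)).exists
  refine ⟨ε, hε, fun q hq => ?_⟩
  rcases lt_or_ge q N with hqN | hqN
  · exact hεf q (Finset.mem_Ico.2 ⟨hq, hqN⟩)
  · exact hεc.trans (hN q hqN)

theorem FiniteExpTypeAtMost.exists_pos_lt {α τ θ : ℝ} (h : FiniteExpTypeAtMost α τ)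
    (hirr : Irrational α) (hθ : τ < θ) :
    ∃ ε > 0, ∀ q : ℕ, 0 < q → ε < exp ((q : ℝ) ^ θ) * nearInt (q * α) := by
  obtain ⟨c, hc, hlim⟩ := EReal.lt_iff_exists_real_btwn.1 (h θ hθ)
  refine exists_pos_lt_of_eventually_lt (EReal.coe_pos.1 hc) (fun q hq => ?_)
    ((eventually_lt_of_lt_liminf hlim).mono fun q hq => EReal.coe_lt_coe_iff.1 hq)
  exact mul_pos (exp_pos _) (hirr.natCast_mul hq.ne').nearInt_pos

theorem eventually_exp_log_rpow_lt {s ε : ℝ} (hs : s < 1) (hε : 0 < ε) :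
    ∀ᶠ Q : ℝ in atTop, exp (log Q ^ s) < ε * Q := by
  have hpow : ∀ᶠ x : ℝ in atTop, x ^ (-(1 - s)) < 1 / 2 :=
    (tendsto_rpow_neg_atTop (sub_pos.2 hs)).eventually_lt_const (by norm_num)
  filter_upwards [tendsto_log_atTop.eventually hpow,
    tendsto_log_atTop.eventually_gt_atTop (-2 * log ε),
    tendsto_log_atTop.eventually_gt_atTop 0, eventually_gt_atTop 0] with Q h1 h2 h3 hQ
  rw [neg_sub, rpow_sub_one h3.ne', div_lt_iff₀ h3] at h1
  rw [← lt_log_iff_exp_lt (mul_pos hε hQ), log_mul hε.ne' hQ.ne']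
  linarith

theorem dioph_approx_finite_exp_type (α τs ϖ : ℝ)
    (hirr : Irrational α) (hτs0 : 0 < τs) (hτs1 : τs < 1)
    (htype : FiniteExpTypeAtMost α τs)
    (hϖ0 : 0 < ϖ) (hϖ1 : ϖ < 1 / τs - 1) :
    ∃ Q₀ > 0, ∀ Q : ℝ, Q₀ ≤ Q →
      ∃ a q : ℤ, Int.gcd a q = 1 ∧ Real.log Q ^ (ϖ + 1) < (q : ℝ) ∧ (q : ℝ) ≤ Q ∧
        |α - (a : ℝ) / q| < 1 / (q * Q) := by
  obtain ⟨θ, hτθ, hθ⟩ : ∃ θ, τs < θ ∧ θ < 1 / (ϖ + 1) :=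
    exists_between ((lt_one_div hτs0 (by linarith)).2 (by linarith))
  have hs : (ϖ + 1) * θ < 1 := by
    rwa [lt_div_iff₀ (by linarith), mul_comm] at hθ
  obtain ⟨ε, hε, hlow⟩ := htype.exists_pos_lt hirr hτθ
  obtain ⟨Q₁, hQ₁⟩ := eventually_atTop.1 (eventually_exp_log_rpow_lt hs hε)
  refine ⟨max Q₁ 1, by positivity, fun Q hQ => ?_⟩
  have hQ1 : 1 ≤ Q := (le_max_right _ _).trans hQ
  have hQ0 : 0 < Q := by linarith
  obtain ⟨r, hr, hden⟩ := exists_rat_abs_sub_le_and_den_le α (Nat.floor_pos.2 hQ1)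
  have hd0 : (0 : ℝ) < r.den := by exact_mod_cast r.den_pos
  have happrox : |α - r| < 1 / (r.den * Q) := by
    refine hr.trans_lt (one_div_lt_one_div_of_lt (by positivity) ?_)
    rw [mul_comm]
    exact mul_lt_mul_of_pos_right (Nat.lt_floor_add_one Q) hd0
  refine ⟨r.num, r.den, r.reduced, ?_, ?_, ?_⟩
  · rw [Int.cast_natCast]
    by_contra! hle
    have hnear : nearInt (r.den * α) < 1 / Q := by
      refine (nearInt_le_abs_sub_intCast _ r.num).trans_lt ?_
      have hnum : (r.num : ℝ) = r.den * r := by exact_mod_cast (Rat.den_mul_eq_num r).symm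
      rw [hnum, ← mul_sub, abs_mul, abs_of_pos hd0]
      calc r.den * |α - r| < r.den * (1 / (r.den * Q)) := by gcongr
        _ = 1 / Q := by field_simp
    have hexp : exp ((r.den : ℝ) ^ θ) ≤ exp (log Q ^ ((ϖ + 1) * θ)) := by
      rw [rpow_mul (log_nonneg hQ1)]
      exact exp_le_exp.2 (rpow_le_rpow hd0.le hle (by linarith))
    have : ε < ε :=
      calc ε < exp ((r.den : ℝ) ^ θ) * nearInt (r.den * α) := hlow _ r.den_pos
        _ ≤ exp (log Q ^ ((ϖ + 1) * θ)) * (1 / Q) :=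
          mul_le_mul hexp hnear.le (hirr.natCast_mul r.den_nz).nearInt_pos.le (exp_pos _).le
        _ < ε * Q * (1 / Q) := by
          gcongr
          exact hQ₁ Q ((le_max_left _ _).trans hQ)
        _ = ε := by field_simp
    exact lt_irrefl _ this
  · rw [Int.cast_natCast]
    exact (Nat.cast_le.2 hden).trans (Nat.floor_le hQ0.le)
  · rwa [Int.cast_natCast, ← Rat.cast_def]
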